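/- Let K ⊂ ℝ^d be a compact convex set containing the origin in its interior, and let ‖x‖_K = inf{λ > 0 : x ∈ λK} be its gauge function. Let A ∈ ℝ^{d×d} be positive definite such that A(B^d) is the largest volume origin-centered ellipsoid contained in K. Then the Gaussian density G[(A⊕1, 0)](x) = e^{−|A^{-1}x|²} is the unique Gaussian density of maximal integral among all Gaussian densities that are pointwise ≤ the log-concave function x ↦ e^{−‖x‖_K²}: every Gaussian density G[(A'⊕α', a')] pointwise ≤ e^{−‖·‖_K²} satisfies ∫ G[(A'⊕α', a')] ≤ ∫ G[(A⊕1, 0)], with equality only if A' = A, α' = 1 and a' = 0. -/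

import Mathlib

open MeasureTheory
open scoped BigOperators RealInnerProductSpace

noncomputable section

/-- `ℝ^d` with the Euclidean structure. -/
abbrev Ed (d : ℕ) := EuclideanSpace ℝ (Fin d)

/-- `f : ℝ^d → [0,∞)` is log-concave, i.e. `f = e^{-ψ}` for some convex
`ψ : ℝ^d → ℝ ∪ {∞}`; equivalently, `f ≥ 0` and
`f(tx+(1-t)y) ≥ f(x)^t f(y)^{1-t}`. -/
def IsLogConcave {d : ℕ} (f : Ed d → ℝ) : Prop :=
  (∀ x, 0 ≤ f x) ∧
    ∀ x y : Ed d, ∀ t : ℝ, 0 ≤ t → t ≤ 1 →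
      f x ^ t * f y ^ (1 - t) ≤ f (t • x + (1 - t) • y)

/-- A proper log-concave function: log-concave, upper semicontinuous,
with positive finite integral. -/
def ProperLogConcave {d : ℕ} (f : Ed d → ℝ) : Prop :=
  IsLogConcave f ∧ UpperSemicontinuous f ∧
    0 < ∫⁻ x, ENNReal.ofReal (f x) ∧ (∫⁻ x, ENNReal.ofReal (f x)) < ⊤

/-- The `s`-lifting of `f`, a subset of `ℝ^d × ℝ = ℝ^{d+1}`. -/
def sLift {d : ℕ} (s : ℝ) (f : Ed d → ℝ) : Set (Ed d × ℝ) :=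
  {p | |p.2| ≤ f p.1 ^ (1 / s)}

/-- The `d`-symmetric ellipsoid `(A⊕α)B^{d+1} + a` in `ℝ^{d+1} = ℝ^d × ℝ`. -/
def ellE {d : ℕ} (A : Matrix (Fin d) (Fin d) ℝ) (α : ℝ) (a : Ed d) : Set (Ed d × ℝ) :=
  {p | ∃ y : Ed d, ∃ t : ℝ, ‖y‖ ^ 2 + t ^ 2 ≤ 1 ∧
        p.1 = Matrix.toEuclideanLin A y + a ∧ p.2 = α * t}

/-- The closed Euclidean unit ball `B^{d+1}` of `ℝ^{d+1} = ℝ^d × ℝ`. -/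
def unitBallE (d : ℕ) : Set (Ed d × ℝ) := {p | ‖p.1‖ ^ 2 + p.2 ^ 2 ≤ 1}

/-- `κ_s = ∫_{B^d} (1-|x|²)^{s/2} dx`. -/
def kappa (d : ℕ) (s : ℝ) : ℝ :=
  ∫ x in Metric.closedBall (0 : Ed d) 1, (1 - ‖x‖ ^ 2) ^ (s / 2)

/-- The `s`-volume of the ellipsoid represented by `(A⊕α, a)`:
`μ_s = κ_s α^s det A`. -/
def svol {d : ℕ} (s : ℝ) (A : Matrix (Fin d) (Fin d) ℝ) (α : ℝ) : ℝ :=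
  kappa d s * α ^ s * A.det

/-- `(A, α, a)` represents the John `s`-ellipsoid of `f`: it is a d-symmetric
ellipsoid contained in the `s`-lifting of `f` of maximal `s`-volume. -/
def IsJohn {d : ℕ} (s : ℝ) (f : Ed d → ℝ)
    (A : Matrix (Fin d) (Fin d) ℝ) (α : ℝ) (a : Ed d) : Prop :=
  A.PosDef ∧ 0 < α ∧ ellE A α a ⊆ sLift s f ∧
    ∀ (A' : Matrix (Fin d) (Fin d) ℝ) (α' : ℝ) (a' : Ed d),
      A'.PosDef → 0 < α' → ellE A' α' a' ⊆ sLift s f → svol s A' α' ≤ svol s A α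

/-- The height function of the ellipsoid represented by `(A⊕α, a)`. -/
def heightFn {d : ℕ} (A : Matrix (Fin d) (Fin d) ℝ) (α : ℝ) (a : Ed d) (x : Ed d) : ℝ :=
  if ‖Matrix.toEuclideanLin A⁻¹ (x - a)‖ ≤ 1 then
    α * Real.sqrt (1 - ‖Matrix.toEuclideanLin A⁻¹ (x - a)‖ ^ 2)
  else 0

/-- A point of `ℝ^d × ℝ` as a vector in `ℝ^{d+1}`. -/
def augVec {d : ℕ} (p : Ed d × ℝ) : Fin (d + 1) → ℝ :=
  Fin.snoc (fun i => p.1 i) p.2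

/-- The block-diagonal matrix `A ⊕ α`. -/
def matAug {d : ℕ} (A : Matrix (Fin d) (Fin d) ℝ) (α : ℝ) :
    Matrix (Fin (d + 1)) (Fin (d + 1)) ℝ :=
  Matrix.of fun i j =>
    Fin.lastCases (Fin.lastCases α (fun _ => 0) j)
      (fun i' => Fin.lastCases 0 (fun j' => A i' j') j) i

/-- The Frobenius norm of a real matrix. -/
def frobNorm {n : ℕ} (M : Matrix (Fin n) (Fin n) ℝ) : ℝ :=
  Real.sqrt (∑ i, ∑ j, M i j ^ 2)

/-- Asplund sum (sup-convolution) of two functions. -/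
def asplund {d : ℕ} (f g : Ed d → ℝ) : Ed d → ℝ :=
  fun x => ⨆ y : Ed d, f y * g (x - y)

/-- Epi-product `(λ ∗ f)(x) = f(x/λ)^λ`. -/
def epiProd {d : ℕ} (l : ℝ) (f : Ed d → ℝ) : Ed d → ℝ :=
  fun x => f (l⁻¹ • x) ^ l

/-- The flat ellipsoid function `α · χ_{A B^d + a}`. -/
def flatFn {d : ℕ} (A : Matrix (Fin d) (Fin d) ℝ) (α : ℝ) (a : Ed d) (x : Ed d) : ℝ :=
  if ‖Matrix.toEuclideanLin A⁻¹ (x - a)‖ ≤ 1 then α else 0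

/-- The Gaussian density `G[(A⊕α, a)](x) = α e^{−|A^{-1}(x−a)|²}`. -/
def gaussFn {d : ℕ} (A : Matrix (Fin d) (Fin d) ℝ) (α : ℝ) (a : Ed d) (x : Ed d) : ℝ :=
  α * Real.exp (-‖Matrix.toEuclideanLin A⁻¹ (x - a)‖ ^ 2)

/-- Operator (`ℓ₂ → ℓ₂`) norm of a matrix. -/
def opNorm {d : ℕ} (M : Matrix (Fin d) (Fin d) ℝ) : ℝ :=
  ‖Matrix.toEuclideanCLM (𝕜 := ℝ) M‖

namespace Matrix

/-- If a positive definite matrix `C ≠ 1` has determinant one, then `det ((1 + C) / 2) > 1`. -/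
theorem PosDef.one_lt_det_half_one_add {n : Type*} [Fintype n] [DecidableEq n]
    {C : Matrix n n ℝ} (hC : C.PosDef) (hdet : C.det = 1) (hne : C ≠ 1) :
    1 < ((1 / 2 : ℝ) • (1 + C)).det := by
  set l := hC.1.eigenvalues
  have hpos : ∀ i, 0 < l i := hC.eigenvalues_pos
  have hprod : ∏ i, l i = 1 := by
    have h := hC.1.det_eq_prod_eigenvalues
    simp only [RCLike.ofReal_real_eq_id, id] at h
    rw [← h, hdet]
  have hdet_eq : ((1 / 2 : ℝ) • (1 + C)).det = ∏ i, (1 + l i) / 2 := by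
    have h := congrArg (Polynomial.eval (-1)) hC.1.charpoly_eq
    have hneg : scalar n (-1 : ℝ) - C = -(1 + C) := by
      rw [map_neg, map_one]; abel
    rw [eval_charpoly, hneg, det_neg, Polynomial.eval_prod] at h
    have h2 : ∏ i, Polynomial.eval (-1 : ℝ) (Polynomial.X - Polynomial.C (l i))
        = (-1) ^ Fintype.card n * ∏ i, (1 + l i) := by
      rw [← Finset.card_univ, ← Finset.prod_const, ← Finset.prod_mul_distrib]
      refine Finset.prod_congr rfl fun i _ => ?_
      simp only [Polynomial.eval_sub, Polynomial.eval_X, Polynomial.eval_C]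
      ring
    have h3 : (1 + C).det = ∏ i, (1 + l i) :=
      mul_left_cancel₀ (pow_ne_zero (Fintype.card n) (by norm_num : (-1 : ℝ) ≠ 0)) (h.trans h2)
    rw [det_smul, h3, ← Finset.card_univ, ← Finset.prod_const, ← Finset.prod_mul_distrib]
    exact Finset.prod_congr rfl fun i _ => by ring
  have hex : ∃ i, l i ≠ 1 := by
    by_contra! h
    apply hne
    have hone : (RCLike.ofReal ∘ hC.1.eigenvalues : n → ℝ) = fun _ => 1 := by
      funext i
      simpa using h i
    have hspec := hC.1.spectral_theorem
    rw [hone, diagonal_one, map_one] at hspec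
    exact hspec
  obtain ⟨i, hi⟩ := hex
  have hlt : ∏ i, l i < ∏ i, ((1 + l i) / 2) ^ 2 := by
    refine Finset.prod_lt_prod (fun j _ => hpos j) (fun j _ => ?_) ⟨i, Finset.mem_univ i, ?_⟩
    · nlinarith [sq_nonneg (1 - l j)]
    · nlinarith [sq_pos_of_ne_zero (sub_ne_zero.2 hi)]
  rw [hprod, Finset.prod_pow, ← hdet_eq] at hlt
  refine (one_lt_sq_iff₀ ?_).1 hlt
  rw [hdet_eq]
  exact Finset.prod_nonneg fun j _ => by linarith [hpos j]

open scoped MatrixOrder Matrix.Norms.L2Operator in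
/-- A positive definite matrix is of the form `Sᴴ * S` with `S` invertible. -/
theorem PosDef.exists_eq_conjTranspose_mul_self {n : Type*} [Fintype n] [DecidableEq n]
    {A : Matrix n n ℝ} (hA : A.PosDef) : ∃ S : Matrix n n ℝ, IsUnit S.det ∧ A = Sᴴ * S := by
  obtain ⟨S, hS⟩ := CStarAlgebra.nonneg_iff_eq_star_mul_self.mp hA.posSemidef.nonneg
  refine ⟨S, ?_, hS⟩
  have h := hA.det_pos.ne'
  rw [hS, det_mul] at h
  exact (right_ne_zero_of_mul h).isUnit

/-- Strict midpoint log-concavity of the determinant on a level set. -/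
theorem PosDef.det_lt_det_midpoint {n : Type*} [Fintype n] [DecidableEq n]
    {A B : Matrix n n ℝ} (hA : A.PosDef) (hB : B.PosDef) (hdet : B.det = A.det) (hne : B ≠ A) :
    A.det < ((1 / 2 : ℝ) • (A + B)).det := by
  obtain ⟨S, hS, rfl⟩ := hA.exists_eq_conjTranspose_mul_self
  have hinv : S⁻¹ * S = 1 := nonsing_inv_mul S hS
  have hinv' : Sᴴ * S⁻¹ᴴ = 1 := by rw [← conjTranspose_mul, hinv, conjTranspose_one]
  set C := S⁻¹ᴴ * B * S⁻¹ with hC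
  have hBC : B = Sᴴ * C * S := by
    calc B = (Sᴴ * S⁻¹ᴴ) * B * (S⁻¹ * S) := by rw [hinv, hinv', Matrix.one_mul, Matrix.mul_one]
      _ = Sᴴ * C * S := by simp only [hC, Matrix.mul_assoc]
  have hCpos : C.PosDef := by
    have hu : IsUnit S⁻¹ := (isUnit_nonsing_inv_iff).2 ((isUnit_iff_isUnit_det S).2 hS)
    exact hB.conjTranspose_mul_mul_same (mulVec_injective_of_isUnit hu)
  have hAdet : (Sᴴ * S).det ≠ 0 := hA.det_pos.ne'
  have hCdet : C.det = 1 := by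
    have h : (Sᴴ * S).det * C.det = (Sᴴ * S).det * 1 := by
      calc (Sᴴ * S).det * C.det = (Sᴴ * C * S).det := by
            simp only [det_mul]
            ring
        _ = (Sᴴ * S).det * 1 := by rw [← hBC, hdet, mul_one]
    exact mul_left_cancel₀ hAdet h
  have hCne : C ≠ 1 := by
    intro h
    rw [h, Matrix.mul_one] at hBC
    exact hne hBC
  have hmid : (1 / 2 : ℝ) • (Sᴴ * S + B) = Sᴴ * ((1 / 2 : ℝ) • (1 + C)) * S := by
    rw [hBC]
    simp only [Matrix.mul_smul, Matrix.smul_mul, Matrix.mul_add, Matrix.add_mul, Matrix.mul_one]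
  have hlt := hCpos.one_lt_det_half_one_add hCdet hCne
  have hfac : (Sᴴ * ((1 / 2 : ℝ) • (1 + C)) * S).det
      = (Sᴴ * S).det * ((1 / 2 : ℝ) • (1 + C)).det := by
    simp only [det_mul]
    ring
  rw [hmid, hfac]
  exact lt_mul_of_one_lt_right hA.det_pos hlt

end Matrix

theorem toEuclideanLin_inv_apply {d : ℕ} {A : Matrix (Fin d) (Fin d) ℝ} (hA : A.PosDef)
    (y : Ed d) : Matrix.toEuclideanLin A⁻¹ (Matrix.toEuclideanLin A y) = y := by
  have h : A⁻¹ * A = 1 := Matrix.nonsing_inv_mul A hA.det_pos.ne'.isUnit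
  rw [← LinearMap.comp_apply, ← Matrix.toLpLin_mul, h, Matrix.toLpLin_one, LinearMap.id_apply]

/-- The integral of a Gaussian density. -/
theorem integral_gaussFn {d : ℕ} {A : Matrix (Fin d) (Fin d) ℝ} (hA : A.PosDef) (α : ℝ)
    (a : Ed d) :
    ∫ x, gaussFn A α a x = α * (Real.pi ^ ((d : ℝ) / 2) * A.det) := by
  have hdet : LinearMap.det (Matrix.toEuclideanLin A⁻¹) = A.det⁻¹ := by
    rw [LinearMap.det_toLpLin, Matrix.det_nonsing_inv, Ring.inverse_eq_inv']
  have hne : LinearMap.det (Matrix.toEuclideanLin A⁻¹) ≠ 0 := by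
    rw [hdet]; exact inv_ne_zero hA.det_pos.ne'
  have hcont : Continuous (Matrix.toEuclideanLin A⁻¹ : Ed d →ₗ[ℝ] Ed d) :=
    LinearMap.continuous_of_finiteDimensional _
  have hmap := Measure.map_linearMap_addHaar_eq_smul_addHaar (volume : Measure (Ed d)) hne
  have hgauss : ∫ y : Ed d, Real.exp (-‖y‖ ^ 2) = Real.pi ^ ((d : ℝ) / 2) := by
    have h := GaussianFourier.integral_rexp_neg_mul_sq_norm (V := Ed d) one_pos
    simpa using h
  have hlin : ∫ x : Ed d, Real.exp (-‖Matrix.toEuclideanLin A⁻¹ x‖ ^ 2)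
      = A.det * Real.pi ^ ((d : ℝ) / 2) := by
    rw [← integral_map (φ := Matrix.toEuclideanLin A⁻¹) (f := fun y => Real.exp (-‖y‖ ^ 2))
      hcont.aemeasurable (by fun_prop), hmap, integral_smul_measure, hgauss, hdet, inv_inv,
      abs_of_pos hA.det_pos, ENNReal.toReal_ofReal hA.det_pos.le, smul_eq_mul]
  simp only [gaussFn]
  rw [integral_const_mul,
    integral_sub_right_eq_self (fun x => Real.exp (-‖Matrix.toEuclideanLin A⁻¹ x‖ ^ 2)) a, hlin]
  ring

section GaussianBelowGauge

variable {d : ℕ} {K : Set (Ed d)} {A : Matrix (Fin d) (Fin d) ℝ} {α : ℝ} {a : Ed d}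

theorem gauge_sq_le_of_gaussFn_le (hA : A.PosDef) (hα : 0 < α)
    (hle : ∀ x, gaussFn A α a x ≤ Real.exp (-gauge K x ^ 2)) (y : Ed d) :
    gauge K (Matrix.toEuclideanLin A y + a) ^ 2 ≤ ‖y‖ ^ 2 - Real.log α := by
  have h := hle (Matrix.toEuclideanLin A y + a)
  rw [gaussFn, add_sub_cancel_right, toEuclideanLin_inv_apply hA] at h
  nth_rewrite 1 [← Real.exp_log hα] at h
  rw [← Real.exp_add, Real.exp_le_exp] at h
  linarith

theorem gauge_center_sq_le_of_gaussFn_le (hA : A.PosDef) (hα : 0 < α)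
    (hle : ∀ x, gaussFn A α a x ≤ Real.exp (-gauge K x ^ 2)) :
    gauge K a ^ 2 ≤ -Real.log α := by
  simpa using gauge_sq_le_of_gaussFn_le hA hα hle 0

/-- If a Gaussian density is below `e^{-‖·‖_K²}`, its shape ellipsoid is contained in `K`. -/
theorem image_closedBall_subset_of_gaussFn_le (hKc : IsCompact K) (hKconv : Convex ℝ K)
    (h0K : (0 : Ed d) ∈ interior K) (hA : A.PosDef) (hα : 0 < α)
    (hle : ∀ x, gaussFn A α a x ≤ Real.exp (-gauge K x ^ 2)) :
    ⇑(Matrix.toEuclideanLin A) '' Metric.closedBall 0 1 ⊆ K := by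
  have hK0 : K ∈ nhds (0 : Ed d) := mem_interior_iff_mem_nhds.1 h0K
  rintro _ ⟨y, hy, rfl⟩
  rw [mem_closedBall_zero_iff] at hy
  rw [← hKc.isClosed.closure_eq, ← gauge_le_one_iff_mem_closure hKconv hK0]
  have hbound : ∀ s : ℝ, 0 < s →
      gauge K (Matrix.toEuclideanLin A y + s • a) ^ 2 ≤ 1 - s ^ 2 * Real.log α := by
    intro s hs
    have h := gauge_sq_le_of_gaussFn_le hA hα hle (s⁻¹ • y)
    have hx : Matrix.toEuclideanLin A y + s • a
        = s • (Matrix.toEuclideanLin A (s⁻¹ • y) + a) := by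
      rw [map_smul, smul_add, smul_inv_smul₀ hs.ne']
    have hny : ‖y‖ ^ 2 ≤ 1 := pow_le_one₀ (norm_nonneg y) hy
    rw [hx, gauge_smul_of_nonneg hs.le, smul_eq_mul, mul_pow]
    calc s ^ 2 * gauge K (Matrix.toEuclideanLin A (s⁻¹ • y) + a) ^ 2
        ≤ s ^ 2 * (‖s⁻¹ • y‖ ^ 2 - Real.log α) := by gcongr
      _ = ‖y‖ ^ 2 - s ^ 2 * Real.log α := by
        rw [norm_smul, norm_inv, Real.norm_of_nonneg hs.le]
        field_simp
      _ ≤ 1 - s ^ 2 * Real.log α := by linarith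
  have hcont := continuous_gauge hKconv hK0
  have hlim : gauge K (Matrix.toEuclideanLin A y + (0 : ℝ) • a) ^ 2
      ≤ 1 - (0 : ℝ) ^ 2 * Real.log α := by
    have hl : Continuous fun s : ℝ => gauge K (Matrix.toEuclideanLin A y + s • a) ^ 2 := by
      fun_prop
    have hr : Continuous fun s : ℝ => 1 - s ^ 2 * Real.log α := by fun_prop
    refine le_of_tendsto_of_tendsto (b := nhdsWithin 0 (Set.Ioi 0))
      (hl.tendsto 0 |>.mono_left nhdsWithin_le_nhds)
      (hr.tendsto 0 |>.mono_left nhdsWithin_le_nhds) ?_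
    filter_upwards [self_mem_nhdsWithin] with s hs using hbound s hs
  have h1 : gauge K (Matrix.toEuclideanLin A y) ^ 2 ≤ 1 := by simpa using hlim
  exact (sq_le_one_iff₀ (gauge_nonneg _)).1 h1

end GaussianBelowGauge

/-- The largest volume origin-centered ellipsoid in a convex set is unique. -/
theorem eq_of_det_eq_of_image_closedBall_subset {d : ℕ} {K : Set (Ed d)} (hKconv : Convex ℝ K)
    {A B : Matrix (Fin d) (Fin d) ℝ} (hA : A.PosDef)
    (hAK : ⇑(Matrix.toEuclideanLin A) '' Metric.closedBall 0 1 ⊆ K)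
    (hAmax : ∀ M : Matrix (Fin d) (Fin d) ℝ, M.PosDef →
      ⇑(Matrix.toEuclideanLin M) '' Metric.closedBall 0 1 ⊆ K → M.det ≤ A.det)
    (hB : B.PosDef) (hBK : ⇑(Matrix.toEuclideanLin B) '' Metric.closedBall 0 1 ⊆ K)
    (hdet : B.det = A.det) : B = A := by
  by_contra hne
  refine (hA.det_lt_det_midpoint hB hdet hne).not_ge (hAmax _ ?_ ?_)
  · exact (hA.add hB).smul (by norm_num)
  · rintro _ ⟨y, hy, rfl⟩
    rw [map_smul, map_add, LinearMap.smul_apply, LinearMap.add_apply, smul_add]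
    exact hKconv (hAK ⟨y, hy, rfl⟩) (hBK ⟨y, hy, rfl⟩) (by norm_num) (by norm_num) (by norm_num)

/-- **Uniqueness of the maximal Gaussian below `e^{-‖·‖_K²}`**
(Proposition 7.3). -/
theorem gaussian_uniqueness_gauge (d : ℕ) (hd : 1 ≤ d)
    (K : Set (Ed d)) (hKc : IsCompact K) (hKconv : Convex ℝ K)
    (h0K : (0 : Ed d) ∈ interior K)
    (A : Matrix (Fin d) (Fin d) ℝ) (hA : A.PosDef)
    (hAK : ⇑(Matrix.toEuclideanLin A) '' Metric.closedBall 0 1 ⊆ K)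
    (hAmax : ∀ M : Matrix (Fin d) (Fin d) ℝ, M.PosDef →
      ⇑(Matrix.toEuclideanLin M) '' Metric.closedBall 0 1 ⊆ K → M.det ≤ A.det) :
    ∀ (A' : Matrix (Fin d) (Fin d) ℝ) (α' : ℝ) (a' : Ed d),
      A'.PosDef → 0 < α' →
      (∀ x, gaussFn A' α' a' x ≤ Real.exp (-gauge K x ^ 2)) →
      (∫ x, gaussFn A' α' a' x) ≤ (∫ x, gaussFn A 1 0 x) ∧
        ((∫ x, gaussFn A' α' a' x) = (∫ x, gaussFn A 1 0 x) →
          A' = A ∧ α' = 1 ∧ a' = 0) := by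
  intro A' α' a' hA' hα' hle
  have hA'K := image_closedBall_subset_of_gaussFn_le hKc hKconv h0K hA' hα' hle
  have hdet : A'.det ≤ A.det := hAmax A' hA' hA'K
  have hlog := gauge_center_sq_le_of_gaussFn_le hA' hα' hle
  have hα1 : α' ≤ 1 := by
    rw [← Real.log_nonpos_iff hα'.le]
    linarith [sq_nonneg (gauge K a')]
  have hpi : 0 < Real.pi ^ ((d : ℝ) / 2) := Real.rpow_pos_of_pos Real.pi_pos _
  rw [integral_gaussFn hA', integral_gaussFn hA, one_mul]
  have hle1 : Real.pi ^ ((d : ℝ) / 2) * A'.det ≤ Real.pi ^ ((d : ℝ) / 2) * A.det := by gcongr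
  have hpos' : 0 < Real.pi ^ ((d : ℝ) / 2) * A'.det := mul_pos hpi hA'.det_pos
  refine ⟨(mul_le_of_le_one_left hpos'.le hα1).trans hle1, fun heq => ?_⟩
  have hα_eq : α' = 1 := by
    refine hα1.antisymm (le_of_mul_le_mul_right ?_ hpos')
    rwa [heq, one_mul]
  subst hα_eq
  rw [one_mul] at heq
  refine ⟨eq_of_det_eq_of_image_closedBall_subset hKconv hA hAK hAmax hA' hA'K
    (mul_left_cancel₀ hpi.ne' heq), rfl, ?_⟩
  rw [Real.log_one, neg_zero] at hlog
  have hg : gauge K a' = 0 := pow_eq_zero_iff two_ne_zero |>.1 (hlog.antisymm (sq_nonneg _))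
  exact (gauge_eq_zero (absorbent_nhds_zero (mem_interior_iff_mem_nhds.1 h0K))
    (NormedSpace.isVonNBounded_of_isBounded ℝ hKc.isBounded)).1 hg
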